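/- Let A be an N-function (increasing continuous convex with A(t)/t → 0 as t → 0 and A(t)/t → ∞ as t → ∞), Ω a bounded Lipschitz domain, and u a nonnegative Lipschitz function on Ω satisfying P_Ω{u > t} ≥ γ·μ(t)^(1−1/n) for all t ≥ 0. Then ∫_{Ω̃} A(|Dũ|/λ₀) dx ≤ ∫_Ω A(|Du|) dx with λ₀ = n·cₙ^(1/n)/γ, and consequently the Orlicz gradient norms satisfy ‖Dũ‖_{L_A(Ω̃)} ≤ λ₀·‖Du‖_{L_A(Ω)}. -/

import Mathlib

open MeasureTheory Set Metric Filter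

/-- The distribution function `μ(t) = |{x ∈ Ω : u(x) > t}|`. -/
noncomputable def distrib {n : ℕ} (Ω : Set (EuclideanSpace ℝ (Fin n)))
    (u : EuclideanSpace ℝ (Fin n) → ℝ) (t : ℝ) : ℝ :=
  (volume {x ∈ Ω | t < u x}).toReal

/-- The decreasing rearrangement `u*(s) = inf {t : μ(t) ≤ s}`. -/
noncomputable def rearr {n : ℕ} (Ω : Set (EuclideanSpace ℝ (Fin n)))
    (u : EuclideanSpace ℝ (Fin n) → ℝ) (s : ℝ) : ℝ :=
  sInf {t : ℝ | distrib Ω u t ≤ s}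

/-- `cₙ`: the volume of the unit ball in `ℝⁿ`. -/
noncomputable def unitBallVol (n : ℕ) : ℝ :=
  (volume (Metric.ball (0 : EuclideanSpace ℝ (Fin n)) 1)).toReal

/-- `Ω̃`: the open ball centred at the origin with the same measure as `Ω`. -/
noncomputable def ballSameVol {n : ℕ} (Ω : Set (EuclideanSpace ℝ (Fin n))) :
    Set (EuclideanSpace ℝ (Fin n)) :=
  Metric.ball 0 (((volume Ω).toReal / unitBallVol n) ^ ((1 : ℝ) / n))

/-- The Schwarz symmetrization `ũ(x) = u*(cₙ |x|ⁿ)`. -/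
noncomputable def schwarz {n : ℕ} (Ω : Set (EuclideanSpace ℝ (Fin n)))
    (u : EuclideanSpace ℝ (Fin n) → ℝ) (x : EuclideanSpace ℝ (Fin n)) : ℝ :=
  rearr Ω u (unitBallVol n * ‖x‖ ^ n)

/-- The De Giorgi perimeter of a set `E` relative to an open set `Ω`, defined by
duality with compactly supported `C¹` vector fields of norm at most one. -/
noncomputable def relPerimeter {n : ℕ} (Ω E : Set (EuclideanSpace ℝ (Fin n))) : ℝ :=
  sSup { r : ℝ | ∃ φ : EuclideanSpace ℝ (Fin n) → EuclideanSpace ℝ (Fin n),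
    ContDiff ℝ 1 φ ∧ HasCompactSupport φ ∧ tsupport φ ⊆ Ω ∧ (∀ x, ‖φ x‖ ≤ 1) ∧
    r = ∫ x in E, ∑ i, fderiv ℝ φ x (EuclideanSpace.single i 1) i }

/-- The Luxemburg norm of `w` in the Orlicz space `L_A(Ω)`. -/
noncomputable def luxNorm {n : ℕ} (A : ℝ → ℝ) (Ω : Set (EuclideanSpace ℝ (Fin n)))
    (w : EuclideanSpace ℝ (Fin n) → ℝ) : ℝ :=
  sInf {lam : ℝ | 0 < lam ∧ ∫ x in Ω, A (|w x| / lam) ≤ 1}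

/-- `A` is an N-function: continuous, increasing, convex on `[0,∞)`,
with `A(t)/t → 0` as `t → 0⁺` and `A(t)/t → ∞` as `t → ∞`. -/
structure IsNFunction (A : ℝ → ℝ) : Prop where
  continuous : ContinuousOn A (Set.Ici 0)
  strictMono : StrictMonoOn A (Set.Ici 0)
  convex : ConvexOn ℝ (Set.Ici 0) A
  tendsto_zero : Filter.Tendsto (fun t => A t / t) (nhdsWithin 0 (Set.Ioi 0)) (nhds 0)
  tendsto_top : Filter.Tendsto (fun t => A t / t) Filter.atTop Filter.atTop

open scoped Topology

/-- The piecewise linear function that is `0` up to `t`, `1` from `t + h` on. -/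
noncomputable def ramp (t h τ : ℝ) : ℝ := max 0 (min 1 ((τ - t) / h))

lemma ramp_nonneg (t h τ : ℝ) : 0 ≤ ramp t h τ := le_max_left _ _

lemma ramp_le_one (t h τ : ℝ) : ramp t h τ ≤ 1 := max_le zero_le_one (min_le_left _ _)

lemma ramp_of_le {t h τ : ℝ} (hh : 0 < h) (hτ : τ ≤ t) : ramp t h τ = 0 :=
  max_eq_left ((min_le_right _ _).trans (div_nonpos_of_nonpos_of_nonneg (by linarith) hh.le))

lemma ramp_of_ge {t h τ : ℝ} (hh : 0 < h) (hτ : t + h ≤ τ) : ramp t h τ = 1 := by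
  have : 1 ≤ (τ - t) / h := by rw [le_div_iff₀ hh]; linarith
  simp [ramp, this]

lemma ramp_of_mem {t h τ : ℝ} (hh : 0 < h) (h1 : t < τ) (h2 : τ < t + h) :
    ramp t h τ = (τ - t) / h := by
  have h3 : (τ - t) / h ≤ 1 := by rw [div_le_iff₀ hh]; linarith
  have h4 : 0 ≤ (τ - t) / h := div_nonneg (by linarith) hh.le
  simp [ramp, h3, h4]

lemma lipschitzWith_ramp (t h : ℝ) : LipschitzWith ‖h⁻¹‖₊ (ramp t h) := by
  have h1 : LipschitzWith ‖h⁻¹‖₊ (fun τ : ℝ => (τ - t) / h) := by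
    refine LipschitzWith.of_dist_le_mul fun x y => ?_
    rw [Real.dist_eq, Real.dist_eq, ← sub_div, div_eq_mul_inv, abs_mul, mul_comm]
    simp
  exact (h1.const_min 1).const_max 0

lemma tendsto_ramp (t τ : ℝ) :
    Tendsto (fun h => ramp t h τ) (𝓝[>] 0) (𝓝 ((Ioi t).indicator 1 τ)) := by
  by_cases hτ : t < τ
  · rw [indicator_of_mem (mem_Ioi.2 hτ)]
    refine tendsto_const_nhds.congr' ?_
    have : Ioo (0 : ℝ) (τ - t) ∈ 𝓝[>] (0 : ℝ) := Ioo_mem_nhdsGT (by linarith)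
    filter_upwards [this] with h hh
    exact (ramp_of_ge hh.1 (by linarith [hh.2])).symm
  · rw [indicator_of_notMem (by simpa using hτ)]
    refine tendsto_const_nhds.congr' ?_
    filter_upwards [self_mem_nhdsWithin] with h hh
    exact (ramp_of_le hh (not_lt.1 hτ)).symm

section Variation

variable {n : ℕ}

lemma norm_fderiv_ramp_comp_le {w : EuclideanSpace ℝ (Fin n) → ℝ} (hw : Continuous w)
    {t h : ℝ} (hh : 0 < h) (x : EuclideanSpace ℝ (Fin n)) :
    ‖fderiv ℝ (fun y => ramp t h (w y)) x‖ ≤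
      h⁻¹ * {y | t < w y ∧ w y < t + h}.indicator (fun y => ‖fderiv ℝ w y‖) x := by
  by_cases hx : t < w x ∧ w x < t + h
  · have hev : (fun y => ramp t h (w y)) =ᶠ[𝓝 x] fun y => h⁻¹ * (w y - t) := by
      have hopen : IsOpen {y | t < w y ∧ w y < t + h} :=
        (isOpen_lt continuous_const hw).inter (isOpen_lt hw continuous_const)
      filter_upwards [hopen.mem_nhds hx] with y hy
      rw [ramp_of_mem hh hy.1 hy.2, div_eq_inv_mul]
    rw [hev.fderiv_eq, indicator_of_mem (by exact hx)]
    have : (fun y => h⁻¹ * (w y - t)) = h⁻¹ • fun y => (w y - t) := rfl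
    rw [this, fderiv_const_smul_field, Pi.smul_apply, fderiv_sub_const, norm_smul, Real.norm_eq_abs,
      abs_of_pos (inv_pos.2 hh)]
  · have h0 : fderiv ℝ (fun y => ramp t h (w y)) x = 0 := by
      rcases le_or_gt (w x) t with h1 | h1
      · refine IsLocalMin.fderiv_eq_zero (Eventually.of_forall fun y => ?_)
        simp only [ramp_of_le hh h1]
        exact ramp_nonneg _ _ _
      · have h2 : t + h ≤ w x := by
          by_contra h3
          exact hx ⟨h1, not_le.1 h3⟩
        refine IsLocalMax.fderiv_eq_zero (Eventually.of_forall fun y => ?_)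
        simp only [ramp_of_ge hh h2]
        exact ramp_le_one _ _ _
    rw [h0, indicator_of_notMem (by exact hx)]
    simp

/-- The divergence of a vector field on `ℝⁿ`. -/
noncomputable def divergence (φ : EuclideanSpace ℝ (Fin n) → EuclideanSpace ℝ (Fin n))
    (x : EuclideanSpace ℝ (Fin n)) : ℝ :=
  ∑ i, fderiv ℝ φ x (EuclideanSpace.single i 1) i

lemma continuous_divergence {φ : EuclideanSpace ℝ (Fin n) → EuclideanSpace ℝ (Fin n)}
    (hφ : ContDiff ℝ 1 φ) : Continuous (divergence φ) := by
  have h1 : Continuous (fderiv ℝ φ) := hφ.continuous_fderiv (by norm_num)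
  unfold divergence
  fun_prop

lemma divergence_eq_zero {φ : EuclideanSpace ℝ (Fin n) → EuclideanSpace ℝ (Fin n)}
    {x : EuclideanSpace ℝ (Fin n)} (hx : x ∉ tsupport φ) : divergence φ x = 0 := by
  have : fderiv ℝ φ x = 0 := by
    by_contra h
    exact hx (support_fderiv_subset ℝ h)
  simp [divergence, this]

lemma integrable_divergence {φ : EuclideanSpace ℝ (Fin n) → EuclideanSpace ℝ (Fin n)}
    (hφ : ContDiff ℝ 1 φ) (hc : HasCompactSupport φ) : Integrable (divergence φ) :=
  (continuous_divergence hφ).integrable_of_hasCompactSupport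
    (hc.mono' fun _ hx => by_contra fun h => hx (divergence_eq_zero h))

/-- Integration by parts for a Lipschitz function against a compactly supported field. -/
lemma integral_mul_divergence {g : EuclideanSpace ℝ (Fin n) → ℝ} {C : NNReal}
    (hg : LipschitzWith C g) {M : ℝ} (hgM : ∀ x, ‖g x‖ ≤ M)
    {φ : EuclideanSpace ℝ (Fin n) → EuclideanSpace ℝ (Fin n)}
    (hφ : ContDiff ℝ 1 φ) (hc : HasCompactSupport φ) :
    ∫ x, g x * divergence φ x = -∫ x, fderiv ℝ g x (φ x) := by
  have hφi : ∀ i, ContDiff ℝ 1 fun x => φ x i := fun i => by fun_prop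
  have hci : ∀ i, HasCompactSupport fun x => φ x i := fun i =>
    hc.comp_left (g := fun v : EuclideanSpace ℝ (Fin n) => v i) rfl
  have hfd : ∀ i x, fderiv ℝ (fun y => φ y i) x (EuclideanSpace.single i 1)
      = fderiv ℝ φ x (EuclideanSpace.single i 1) i := fun i x => by
    have h1 := ((EuclideanSpace.proj i : EuclideanSpace ℝ (Fin n) →L[ℝ] ℝ).hasFDerivAt.comp x
      (hφ.differentiable (by norm_num) x).hasFDerivAt).fderiv
    have h2 : (fun y => φ y i) = (EuclideanSpace.proj i : EuclideanSpace ℝ (Fin n) →L[ℝ] ℝ) ∘ φ :=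
      rfl
    rw [h2, h1]
    rfl
  have hparts : ∀ i, ∫ x, g x * fderiv ℝ φ x (EuclideanSpace.single i 1) i
      = -∫ x, lineDeriv ℝ g x (EuclideanSpace.single i 1) * φ x i := fun i => by
    obtain ⟨D, hD⟩ := (hφi i).lipschitzWith_of_hasCompactSupport (hci i) (by norm_num)
    rw [LipschitzWith.integral_lineDeriv_mul_eq hg hD (hci i), ← integral_neg]
    congr 1
    ext x
    rw [((hφi i).differentiable (by norm_num) x).lineDeriv_eq_fderiv, map_neg, hfd]
    ring
  have hint1 : ∀ i, Integrable fun x => g x * fderiv ℝ φ x (EuclideanSpace.single i 1) i :=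
    fun i => by
    refine Integrable.bdd_mul (c := M) ?_ hg.continuous.aestronglyMeasurable
      (Eventually.of_forall hgM)
    have h1 : Continuous (fderiv ℝ φ) := hφ.continuous_fderiv (by norm_num)
    refine Continuous.integrable_of_hasCompactSupport (by fun_prop) ?_
    exact (hc.fderiv ℝ).comp_left
      (g := fun T : EuclideanSpace ℝ (Fin n) →L[ℝ] EuclideanSpace ℝ (Fin n) =>
        T (EuclideanSpace.single i 1) i) rfl
  have hint2 : ∀ i, Integrable fun x => lineDeriv ℝ g x (EuclideanSpace.single i 1) * φ x i :=
    fun i => by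
    refine Integrable.bdd_mul (c := C * ‖(EuclideanSpace.single i 1 : EuclideanSpace ℝ (Fin n))‖)
      ?_ (stronglyMeasurable_lineDeriv hg.continuous).aestronglyMeasurable
      (Eventually.of_forall fun x => norm_lineDeriv_le_of_lipschitz ℝ hg)
    exact (hφi i).continuous.integrable_of_hasCompactSupport (hci i)
  simp only [divergence, Finset.mul_sum]
  rw [integral_finsetSum _ fun i _ => hint1 i]
  simp only [hparts]
  rw [Finset.sum_neg_distrib, ← integral_finsetSum _ fun i _ => hint2 i]
  congr 1
  refine integral_congr_ae ?_
  filter_upwards [hg.ae_differentiableAt] with x hx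
  have hsum : φ x = ∑ i, φ x i • (EuclideanSpace.single i 1 : EuclideanSpace ℝ (Fin n)) := by
    ext j
    simp [Finset.sum_apply, Pi.single_apply]
  conv_rhs => rw [hsum, map_sum]
  refine Finset.sum_congr rfl fun i _ => ?_
  rw [hx.lineDeriv_eq_fderiv, map_smul, smul_eq_mul, mul_comm]

end Variation

section Perimeter

variable {n : ℕ} {Ω : Set (EuclideanSpace ℝ (Fin n))} {w : EuclideanSpace ℝ (Fin n) → ℝ}
  {L : NNReal}

lemma integrableOn_comp_norm_fderiv (hΩ : volume Ω ≠ ⊤) (hw : LipschitzWith L w)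
    {B : ℝ → ℝ} (hB : Continuous B) : IntegrableOn (fun x => B ‖fderiv ℝ w x‖) Ω := by
  obtain ⟨K, hK⟩ := (isCompact_Icc (a := (0 : ℝ)) (b := L)).exists_bound_of_continuousOn
    hB.continuousOn
  refine IntegrableOn.of_bound hΩ.lt_top ?_ K (Eventually.of_forall fun x => ?_)
  · exact (hB.measurable.comp (measurable_fderiv ℝ w).norm).aestronglyMeasurable
  · exact hK _ ⟨norm_nonneg _, norm_fderiv_le_of_lipschitz ℝ hw⟩

lemma setIntegral_ramp_mul_divergence_le (hΩo : IsOpen Ω) (hΩ : volume Ω ≠ ⊤)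
    (hw : LipschitzWith L w) {t h : ℝ} (hh : 0 < h)
    {φ : EuclideanSpace ℝ (Fin n) → EuclideanSpace ℝ (Fin n)}
    (hφ : ContDiff ℝ 1 φ) (hc : HasCompactSupport φ) (hs : tsupport φ ⊆ Ω)
    (h1 : ∀ x, ‖φ x‖ ≤ 1) :
    ∫ x in Ω, ramp t h (w x) * divergence φ x ≤
      h⁻¹ * ∫ x in {x ∈ Ω | t < w x ∧ w x < t + h}, ‖fderiv ℝ w x‖ := by
  have hg : LipschitzWith (‖h⁻¹‖₊ * L) fun x => ramp t h (w x) := (lipschitzWith_ramp t h).comp hw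
  have hgM : ∀ x, ‖ramp t h (w x)‖ ≤ 1 := fun x => by
    rw [Real.norm_eq_abs, abs_of_nonneg (ramp_nonneg _ _ _)]
    exact ramp_le_one _ _ _
  have hEm : MeasurableSet {x ∈ Ω | t < w x ∧ w x < t + h} :=
    (hΩo.inter ((isOpen_lt continuous_const hw.continuous).inter
      (isOpen_lt hw.continuous continuous_const))).measurableSet
  rw [setIntegral_eq_integral_of_forall_compl_eq_zero fun x hx => by
    rw [divergence_eq_zero fun h' => hx (hs h'), mul_zero], integral_mul_divergence hg hgM hφ hc,
    ← integral_neg, ← integral_const_mul, ← integral_indicator hEm]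
  have hint : Integrable ({x ∈ Ω | t < w x ∧ w x < t + h}.indicator
      fun x => h⁻¹ * ‖fderiv ℝ w x‖) := by
    rw [integrable_indicator_iff hEm]
    exact ((integrableOn_comp_norm_fderiv hΩ hw continuous_id).mono_set
      fun x hx => hx.1).const_mul h⁻¹
  have hpt : ∀ x, ‖-(fderiv ℝ (fun y => ramp t h (w y)) x (φ x))‖ ≤
      {x ∈ Ω | t < w x ∧ w x < t + h}.indicator (fun x => h⁻¹ * ‖fderiv ℝ w x‖) x := fun x => by
    rw [norm_neg]
    by_cases hx : x ∈ Ω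
    · refine (ContinuousLinearMap.le_of_opNorm_le_of_le _
        (norm_fderiv_ramp_comp_le hw.continuous hh x) (h1 x)).trans (le_of_eq ?_)
      by_cases hx2 : t < w x ∧ w x < t + h
      · simp [indicator, hx, hx2]
      · simp only [indicator, mem_ofPred_eq, hx, hx2, and_false, if_false, mul_zero, zero_mul]
    · rw [image_eq_zero_of_notMem_tsupport fun h' => hx (hs h'), map_zero, norm_zero]
      exact indicator_nonneg (fun _ _ => mul_nonneg (inv_pos.2 hh).le (norm_nonneg _)) _
  refine integral_mono_ae ?_ hint (Eventually.of_forall fun x => (le_abs_self _).trans (hpt x))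
  refine hint.mono' ?_ (Eventually.of_forall hpt)
  have hm : Measurable fun x => fderiv ℝ (fun y => ramp t h (w y)) x := measurable_fderiv ℝ _
  have := hφ.continuous.measurable
  exact (isBoundedBilinearMap_apply (𝕜 := ℝ)
    (E := EuclideanSpace ℝ (Fin n)) (F := ℝ)).continuous.measurable.comp
    (hm.prodMk this) |>.neg.aestronglyMeasurable

/-- The relative perimeter of a superlevel set is at most the lower limit of the average slopes
over thin layers above the level. -/
lemma eventually_lt_of_lt_relPerimeter (hΩo : IsOpen Ω) (hΩ : volume Ω ≠ ⊤)
    (hw : LipschitzWith L w) {t a : ℝ} (ha : a < relPerimeter Ω {x ∈ Ω | t < w x}) :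
    ∀ᶠ h in 𝓝[>] (0 : ℝ),
      a < h⁻¹ * ∫ x in {x ∈ Ω | t < w x ∧ w x < t + h}, ‖fderiv ℝ w x‖ := by
  obtain ⟨_, ⟨φ, hφ, hc, hs, h1, rfl⟩, hlt⟩ := exists_lt_of_lt_csSup
    (by exact ⟨0, 0, contDiff_const, HasCompactSupport.zero, by simp [tsupport], by simp,
      by simp⟩) ha
  have hm : MeasurableSet {x | t < w x} :=
    (isOpen_lt continuous_const hw.continuous).measurableSet
  have hlim : Tendsto (fun h => ∫ x in Ω, ramp t h (w x) * divergence φ x) (𝓝[>] 0)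
      (𝓝 (∫ x in Ω, (Ioi t).indicator 1 (w x) * divergence φ x)) := by
    refine tendsto_integral_filter_of_dominated_convergence (fun x => ‖divergence φ x‖) ?_ ?_
      (integrable_divergence hφ hc).norm.integrableOn ?_
    · refine Eventually.of_forall fun h => Continuous.aestronglyMeasurable ?_
      exact ((lipschitzWith_ramp t h).continuous.comp hw.continuous).mul
        (continuous_divergence hφ)
    · refine Eventually.of_forall fun h => Eventually.of_forall fun x => ?_
      rw [norm_mul, Real.norm_eq_abs, abs_of_nonneg (ramp_nonneg _ _ _)]
      exact mul_le_of_le_one_left (norm_nonneg _) (ramp_le_one _ _ _)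
    · exact Eventually.of_forall fun x => (tendsto_ramp t (w x)).mul_const _
  have heq : ∫ x in Ω, (Ioi t).indicator 1 (w x) * divergence φ x =
      ∫ x in {x ∈ Ω | t < w x}, divergence φ x := by
    have : ∀ x, (Ioi t).indicator 1 (w x) * divergence φ x =
        {x | t < w x}.indicator (divergence φ) x := fun x => by
      by_cases hx : t < w x <;> simp [indicator, hx]
    simp only [this]
    rw [setIntegral_indicator hm]
    rfl
  rw [heq] at hlim
  filter_upwards [hlim.eventually_const_lt hlt, self_mem_nhdsWithin] with h h2 h3
  exact h2.trans_le (setIntegral_ramp_mul_divergence_le hΩo hΩ hw h3 hφ hc hs h1)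

end Perimeter

section NFunction

variable {A : ℝ → ℝ}

lemma IsNFunction.map_zero (hA : IsNFunction A) : A 0 = 0 := by
  have h1 : Tendsto A (𝓝[>] 0) (𝓝 (A 0)) :=
    ((hA.continuous 0 self_mem_Ici).mono Ioi_subset_Ici_self)
  have h2 : Tendsto (fun t => A t / t * t) (𝓝[>] 0) (𝓝 (0 * 0)) :=
    hA.tendsto_zero.mul (tendsto_id.mono_left nhdsWithin_le_nhds)
  rw [zero_mul] at h2
  refine tendsto_nhds_unique h1 (h2.congr' ?_)
  filter_upwards [self_mem_nhdsWithin] with t ht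
  exact div_mul_cancel₀ _ (ne_of_gt ht)

lemma IsNFunction.mono (hA : IsNFunction A) {s t : ℝ} (hs : 0 ≤ s) (hst : s ≤ t) : A s ≤ A t :=
  hA.strictMono.monotoneOn hs (hs.trans hst) hst

lemma IsNFunction.nonneg (hA : IsNFunction A) {t : ℝ} (ht : 0 ≤ t) : 0 ≤ A t :=
  hA.map_zero ▸ hA.mono le_rfl ht

lemma IsNFunction.continuous_abs (hA : IsNFunction A) : Continuous fun t => A |t| :=
  hA.continuous.comp_continuous _root_.continuous_abs fun t => abs_nonneg t

lemma IsNFunction.comp_div (hA : IsNFunction A) {l : ℝ} (hl : 0 < l) :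
    IsNFunction fun t => A (t / l) := by
  have hmaps : MapsTo (fun t : ℝ => t / l) (Ici 0) (Ici 0) := fun t ht => div_nonneg ht hl.le
  refine ⟨hA.continuous.comp (by fun_prop) hmaps, fun s hs t ht hst =>
    hA.strictMono (hmaps hs) (hmaps ht) ((div_lt_div_iff_of_pos_right hl).2 hst),
    ⟨convex_Ici 0, fun x hx y hy a b ha hb hab => ?_⟩,
    ?_, ?_⟩
  · have := hA.convex.2 (hmaps hx) (hmaps hy) ha hb hab
    simp only [smul_eq_mul] at this ⊢
    rwa [add_div, mul_div_assoc, mul_div_assoc]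
  · have h1 : Tendsto (fun t : ℝ => t / l) (𝓝[>] 0) (𝓝[>] 0) := by
      refine tendsto_nhdsWithin_iff.2 ⟨?_, ?_⟩
      · have : Tendsto (fun t : ℝ => t / l) (𝓝 0) (𝓝 (0 / l)) := tendsto_id.div_const l
        rw [zero_div] at this
        exact this.mono_left nhdsWithin_le_nhds
      · filter_upwards [self_mem_nhdsWithin] with t ht using div_pos ht hl
    have h2 := (hA.tendsto_zero.comp h1).div_const l
    rw [zero_div] at h2
    refine h2.congr fun t => ?_
    simp only [Function.comp]
    field_simp
  · have h2 := (hA.tendsto_top.comp (tendsto_id.atTop_div_const hl)).atTop_div_const hl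
    refine h2.congr fun t => ?_
    simp only [Function.comp, id]
    field_simp

/-- Jensen's inequality over a set whose measure is at most the normalizing constant. -/
lemma IsNFunction.map_setIntegral_le (hA : IsNFunction A) {X : Type*} [MeasurableSpace X]
    {ν : Measure X} {E : Set X} (hE : ν E ≠ ⊤) {m : ℝ} (hm : 0 < m) (hEm : ν.real E ≤ m)
    {f : X → ℝ} (hf0 : ∀ x, 0 ≤ f x) (hf : IntegrableOn f E ν)
    (hAf : IntegrableOn (fun x => A (f x)) E ν) :
    A (m⁻¹ * ∫ x in E, f x ∂ν) ≤ m⁻¹ * ∫ x in E, A (f x) ∂ν := by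
  by_cases h0 : ν E = 0
  · have : ν.restrict E = 0 := Measure.restrict_eq_zero.2 h0
    simp [this, hA.map_zero]
  have hv : 0 < ν.real E := ENNReal.toReal_pos h0 hE
  have hJ := hA.convex.map_set_average_le hA.continuous isClosed_Ici h0 hE
    (Eventually.of_forall fun x => hf0 x) hf hAf
  rw [setAverage_eq, setAverage_eq, smul_eq_mul, smul_eq_mul] at hJ
  set I := ∫ x in E, f x ∂ν
  have hI0 : 0 ≤ I := integral_nonneg fun x => hf0 x
  have hth : ν.real E / m ≤ 1 := (div_le_one hm).2 hEm
  have hth0 : 0 ≤ ν.real E / m := by positivity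
  have hC := hA.convex.2 (x := (ν.real E)⁻¹ * I) (y := 0) (by simp only [mem_Ici]; positivity)
    self_mem_Ici hth0 (sub_nonneg.2 hth) (by ring)
  simp only [smul_eq_mul, mul_zero, add_zero, hA.map_zero] at hC
  have e1 : ν.real E / m * ((ν.real E)⁻¹ * I) = m⁻¹ * I := by field_simp
  rw [e1] at hC
  refine hC.trans ((mul_le_mul_of_nonneg_left hJ hth0).trans (le_of_eq ?_))
  field_simp

end NFunction

section Rearrangement

variable {n : ℕ} {Ω : Set (EuclideanSpace ℝ (Fin n))} {w : EuclideanSpace ℝ (Fin n) → ℝ}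

lemma measureReal_iUnion_le_of_monotone {X : Type*} [MeasurableSpace X] {ν : Measure X}
    {S : ℕ → Set X} (hS : Monotone S) {c : ℝ} (hfin : ∀ j, ν (S j) ≠ ⊤)
    (h : ∀ j, ν.real (S j) ≤ c) : ν.real (⋃ j, S j) ≤ c := by
  have hc : 0 ≤ c := measureReal_nonneg.trans (h 0)
  refine ENNReal.toReal_le_of_le_ofReal hc ?_
  rw [hS.measure_iUnion]
  exact iSup_le fun j => (ENNReal.le_ofReal_iff_toReal_le (hfin j) hc).2 (h j)

lemma distrib_antitone (hΩ : volume Ω ≠ ⊤) : Antitone (distrib Ω w) := fun _ _ hst =>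
  ENNReal.toReal_mono (measure_ne_top_of_subset (fun _ hx => hx.1) hΩ)
    (measure_mono fun _ hx => ⟨hx.1, hst.trans_lt hx.2⟩)

lemma distrib_le (hΩ : volume Ω ≠ ⊤) (t : ℝ) : distrib Ω w t ≤ (volume Ω).toReal :=
  ENNReal.toReal_mono hΩ (measure_mono fun _ hx => hx.1)

lemma distrib_of_neg (hw0 : ∀ x ∈ Ω, 0 ≤ w x) {t : ℝ} (ht : t < 0) :
    distrib Ω w t = (volume Ω).toReal := by
  have : {x ∈ Ω | t < w x} = Ω := by
    ext x
    exact ⟨fun h => h.1, fun h => ⟨h, ht.trans_le (hw0 x h)⟩⟩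
  rw [distrib, this]

lemma nonneg_of_distrib_le (hw0 : ∀ x ∈ Ω, 0 ≤ w x) {s t : ℝ} (hs : s < (volume Ω).toReal)
    (ht : distrib Ω w t ≤ s) : 0 ≤ t := by
  by_contra h
  rw [distrib_of_neg hw0 (not_le.1 h)] at ht
  exact absurd hs (not_lt.2 ht)

lemma rearr_volume (hΩ : volume Ω ≠ ⊤) : rearr Ω w (volume Ω).toReal = 0 := by
  have : {t : ℝ | distrib Ω w t ≤ (volume Ω).toReal} = univ :=
    eq_univ_of_forall fun t => distrib_le hΩ t
  rw [rearr, this, Real.sInf_univ]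

lemma bddBelow_distrib_le (hw0 : ∀ x ∈ Ω, 0 ≤ w x) {s : ℝ} (hs : s < (volume Ω).toReal) :
    BddBelow {t : ℝ | distrib Ω w t ≤ s} :=
  ⟨0, fun _ ht => nonneg_of_distrib_le hw0 hs ht⟩

lemma rearr_le (hw0 : ∀ x ∈ Ω, 0 ≤ w x) {s t : ℝ} (hs : s < (volume Ω).toReal)
    (ht : distrib Ω w t ≤ s) : rearr Ω w s ≤ t :=
  csInf_le (bddBelow_distrib_le hw0 hs) ht

lemma rearr_nonneg (hΩ : volume Ω ≠ ⊤) (hw0 : ∀ x ∈ Ω, 0 ≤ w x) {s : ℝ}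
    (hs : s ≤ (volume Ω).toReal) : 0 ≤ rearr Ω w s := by
  rcases hs.eq_or_lt with rfl | hs
  · exact (rearr_volume hΩ).ge
  · exact Real.sInf_nonneg fun t ht => nonneg_of_distrib_le hw0 hs ht

lemma exists_distrib_le {K : ℝ} (hK : ∀ x ∈ Ω, w x ≤ K) {s : ℝ} (hs : 0 ≤ s) :
    {t : ℝ | distrib Ω w t ≤ s}.Nonempty := by
  refine ⟨K, ?_⟩
  have : {x ∈ Ω | K < w x} = ∅ := by
    ext x
    simpa using fun h => hK x h
  simpa [distrib, this] using hs

lemma rearr_antitoneOn (hΩ : volume Ω ≠ ⊤) (hw0 : ∀ x ∈ Ω, 0 ≤ w x) {K : ℝ}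
    (hK : ∀ x ∈ Ω, w x ≤ K) : AntitoneOn (rearr Ω w) (Icc 0 (volume Ω).toReal) := by
  intro s hs s' hs' hss'
  rcases hs'.2.eq_or_lt with h | h
  · rw [h, rearr_volume hΩ]
    exact rearr_nonneg hΩ hw0 hs.2
  · exact csInf_le_csInf (bddBelow_distrib_le hw0 h) (exists_distrib_le hK hs.1)
      fun t ht => le_trans ht hss'

lemma lt_distrib_of_lt_rearr (hw0 : ∀ x ∈ Ω, 0 ≤ w x) {s τ : ℝ} (hs : s < (volume Ω).toReal)
    (h : τ < rearr Ω w s) : s < distrib Ω w τ := by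
  by_contra h'
  exact absurd (rearr_le hw0 hs (not_lt.1 h')) (not_le.2 h)

lemma distrib_rearr_le (hΩ : volume Ω ≠ ⊤) {K : ℝ}
    (hK : ∀ x ∈ Ω, w x ≤ K) {s : ℝ} (hs : 0 ≤ s) :
    distrib Ω w (rearr Ω w s) ≤ s := by
  set t := rearr Ω w s with ht
  have hlt : ∀ t' > t, distrib Ω w t' ≤ s := fun t' h => by
    obtain ⟨t'', h1, h2⟩ := exists_lt_of_csInf_lt (exists_distrib_le hK hs) h
    exact (distrib_antitone hΩ h2.le).trans h1
  have hU : {x ∈ Ω | t < w x} = ⋃ j : ℕ, {x ∈ Ω | t + 1 / ((j : ℝ) + 1) < w x} := by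
    ext x
    simp only [mem_iUnion, mem_ofPred_eq]
    constructor
    · rintro ⟨h1, h2⟩
      obtain ⟨j, hj⟩ := exists_nat_one_div_lt (sub_pos.2 h2)
      exact ⟨j, h1, by linarith⟩
    · rintro ⟨j, h1, h2⟩
      have : (0 : ℝ) < 1 / ((j : ℝ) + 1) := by positivity
      exact ⟨h1, by linarith⟩
  change volume.real _ ≤ s
  rw [hU]
  refine measureReal_iUnion_le_of_monotone ?_
    (fun j => measure_ne_top_of_subset (fun _ hx => hx.1) hΩ) fun j => hlt _ ?_
  · intro i j hij x hx
    refine ⟨hx.1, lt_of_le_of_lt ?_ hx.2⟩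
    have : 1 / ((j : ℝ) + 1) ≤ 1 / ((i : ℝ) + 1) := Nat.one_div_le_one_div hij
    linarith
  · have : (0 : ℝ) < 1 / ((j : ℝ) + 1) := by positivity
    linarith

/-- The layer between two values of the rearrangement has measure at most the difference of the
corresponding arguments. -/
lemma measureReal_layer_le (hΩo : IsOpen Ω) (hΩ : volume Ω ≠ ⊤) (hwc : Continuous w)
    (hw0 : ∀ x ∈ Ω, 0 ≤ w x) {K : ℝ} (hK : ∀ x ∈ Ω, w x ≤ K) {s s' : ℝ} (hs' : 0 ≤ s')
    (hss' : s' ≤ s) (hs : s < (volume Ω).toReal) :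
    volume.real {x ∈ Ω | rearr Ω w s < w x ∧ w x < rearr Ω w s'} ≤ s - s' := by
  set t := rearr Ω w s with ht
  set t' := rearr Ω w s' with ht'
  have hfin : ∀ τ, volume {x ∈ Ω | τ < w x} ≠ ⊤ := fun τ =>
    measure_ne_top_of_subset (fun _ hx => hx.1) hΩ
  have hU : {x ∈ Ω | t < w x ∧ w x < t'} =
      ⋃ j : ℕ, {x ∈ Ω | t < w x ∧ w x ≤ t' - 1 / ((j : ℝ) + 1)} := by
    ext x
    simp only [mem_iUnion, mem_ofPred_eq]
    constructor
    · rintro ⟨h1, h2, h3⟩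
      obtain ⟨j, hj⟩ := exists_nat_one_div_lt (sub_pos.2 h3)
      exact ⟨j, h1, h2, by linarith⟩
    · rintro ⟨j, h1, h2, h3⟩
      have : (0 : ℝ) < 1 / ((j : ℝ) + 1) := by positivity
      exact ⟨h1, h2, by linarith⟩
  rw [hU]
  refine measureReal_iUnion_le_of_monotone ?_
    (fun j => measure_ne_top_of_subset (fun _ hx => hx.1) hΩ) fun j => ?_
  · intro i j hij x hx
    refine ⟨hx.1, hx.2.1, hx.2.2.trans ?_⟩
    have : 1 / ((j : ℝ) + 1) ≤ 1 / ((i : ℝ) + 1) := Nat.one_div_le_one_div hij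
    linarith
  · have hj : (0 : ℝ) < 1 / ((j : ℝ) + 1) := by positivity
    set τ := t' - 1 / ((j : ℝ) + 1) with hτ
    have h1 : s' < distrib Ω w τ := lt_distrib_of_lt_rearr hw0 (hss'.trans_lt hs) (by linarith)
    have h2 : distrib Ω w t ≤ s := distrib_rearr_le hΩ hK (hs'.trans hss')
    rcases le_or_gt t τ with h3 | h3
    · have hsub : {x ∈ Ω | τ < w x} ⊆ {x ∈ Ω | t < w x} := fun x hx => ⟨hx.1, h3.trans_lt hx.2⟩
      have hm : MeasurableSet {x ∈ Ω | τ < w x} :=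
        (hΩo.inter (isOpen_lt continuous_const hwc)).measurableSet
      have heq : {x ∈ Ω | t < w x ∧ w x ≤ τ} = {x ∈ Ω | t < w x} \ {x ∈ Ω | τ < w x} := by
        ext x
        simp only [Set.mem_sdiff, mem_ofPred_eq, not_and, not_lt]
        tauto
      rw [heq, measureReal_sdiff hsub hm (hfin _)]
      change distrib Ω w t - distrib Ω w τ ≤ s - s'
      linarith
    · have : {x ∈ Ω | t < w x ∧ w x ≤ τ} = ∅ := by
        ext x
        simp only [mem_ofPred_eq, mem_empty_iff_false, iff_false]
        rintro ⟨-, h4, h5⟩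
        linarith
      rw [this, measureReal_empty]
      linarith

end Rearrangement

section Radial

lemma tendsto_const_sub_nhdsGT_zero (r : ℝ) :
    Tendsto (fun k : ℝ => r - k) (𝓝[>] 0) (𝓝 r) := by
  have : Tendsto (fun k : ℝ => r - k) (𝓝 0) (𝓝 (r - 0)) :=
    (continuous_const.sub continuous_id).tendsto 0
  rw [sub_zero] at this
  exact this.mono_left nhdsWithin_le_nhds

lemma HasDerivAt.tendsto_left_slope {f : ℝ → ℝ} {f' r : ℝ} (hf : HasDerivAt f f' r) :
    Tendsto (fun k => (f r - f (r - k)) / k) (𝓝[>] 0) (𝓝 f') := by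
  have h1 : Tendsto (fun k : ℝ => r - k) (𝓝[>] 0) (𝓝[≠] r) := by
    refine tendsto_nhdsWithin_iff.2 ⟨tendsto_const_sub_nhdsGT_zero r, ?_⟩
    filter_upwards [self_mem_nhdsWithin] with k hk
    have : 0 < k := hk
    simp [this.ne']
  refine (hf.tendsto_slope.comp h1).congr fun k => ?_
  simp only [Function.comp, slope_def_field]
  rw [← neg_div_neg_eq, neg_sub]
  congr 1
  ring

lemma rpow_isoperimetric_identity {n : ℕ} (hn : n ≠ 0) {c r γ q : ℝ} (hc : 0 < c) (hr : 0 < r)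
    (hγ : 0 < γ) :
    q / (c * (n * r ^ (n - 1))) * (γ * (c * r ^ n) ^ ((1 : ℝ) - 1 / n)) =
      q / (n * c ^ ((1 : ℝ) / n) / γ) := by
  have hn' : (n : ℝ) ≠ 0 := Nat.cast_ne_zero.2 hn
  have h1 : (c * r ^ n) ^ ((1 : ℝ) - 1 / n) = c * r ^ (n - 1) / c ^ ((1 : ℝ) / n) := by
    rw [Real.rpow_sub (by positivity), Real.rpow_one, Real.mul_rpow hc.le (by positivity),
      one_div, Real.pow_rpow_inv_natCast hr.le hn]
    obtain ⟨m, rfl⟩ := Nat.exists_eq_succ_of_ne_zero hn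
    have := (Real.rpow_pos_of_pos hc (((m.succ : ℕ) : ℝ)⁻¹)).ne'
    rw [Nat.succ_sub_one, pow_succ]
    field_simp
  have h2 := (Real.rpow_pos_of_pos hc ((1 : ℝ) / n)).ne'
  rw [h1]
  field_simp

variable {n : ℕ} {A : ℝ → ℝ} {Ω : Set (EuclideanSpace ℝ (Fin n))}
  {w : EuclideanSpace ℝ (Fin n) → ℝ} {L : NNReal}

/-- The Orlicz energy of `w` on the superlevel set at height `t`. -/
noncomputable def superlevelEnergy (A : ℝ → ℝ) (Ω : Set (EuclideanSpace ℝ (Fin n)))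
    (w : EuclideanSpace ℝ (Fin n) → ℝ) (t : ℝ) : ℝ :=
  ∫ x in {x ∈ Ω | t < w x}, A ‖fderiv ℝ w x‖

lemma IsNFunction.integrableOn_norm_fderiv (hA : IsNFunction A) (hΩ : volume Ω ≠ ⊤)
    (hw : LipschitzWith L w) : IntegrableOn (fun x => A ‖fderiv ℝ w x‖) Ω := by
  simpa using integrableOn_comp_norm_fderiv hΩ hw hA.continuous_abs

lemma superlevelEnergy_nonneg (hA : IsNFunction A) (t : ℝ) : 0 ≤ superlevelEnergy A Ω w t :=
  integral_nonneg fun _ => hA.nonneg (norm_nonneg _)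

lemma superlevelEnergy_le (hA : IsNFunction A) (hΩ : volume Ω ≠ ⊤) (hw : LipschitzWith L w)
    (t : ℝ) : superlevelEnergy A Ω w t ≤ ∫ x in Ω, A ‖fderiv ℝ w x‖ :=
  setIntegral_mono_set (hA.integrableOn_norm_fderiv hΩ hw)
    (Eventually.of_forall fun _ => hA.nonneg (norm_nonneg _))
    (LE.le.eventuallyLE fun _ hx => hx.1)

lemma superlevelEnergy_antitone (hA : IsNFunction A) (hΩ : volume Ω ≠ ⊤)
    (hw : LipschitzWith L w) : Antitone (superlevelEnergy A Ω w) := fun _ _ hst =>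
  setIntegral_mono_set ((hA.integrableOn_norm_fderiv hΩ hw).mono_set fun _ hx => hx.1)
    (Eventually.of_forall fun _ => hA.nonneg (norm_nonneg _))
    (LE.le.eventuallyLE fun _ hx => ⟨hx.1, hst.trans_lt hx.2⟩)

lemma setIntegral_layer_le (hA : IsNFunction A) (hΩo : IsOpen Ω) (hΩ : volume Ω ≠ ⊤)
    (hw : LipschitzWith L w) {t t' : ℝ} (htt' : t ≤ t') :
    ∫ x in {x ∈ Ω | t < w x ∧ w x < t'}, A ‖fderiv ℝ w x‖ ≤
      superlevelEnergy A Ω w t - superlevelEnergy A Ω w t' := by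
  have hm : MeasurableSet {x ∈ Ω | t' < w x} :=
    (hΩo.inter (isOpen_lt continuous_const hw.continuous)).measurableSet
  have hint := hA.integrableOn_norm_fderiv hΩ hw
  have hdisj : Disjoint {x ∈ Ω | t < w x ∧ w x < t'} {x ∈ Ω | t' < w x} :=
    Set.disjoint_left.2 fun x hx hx' => absurd hx.2.2 (not_lt.2 hx'.2.le)
  rw [le_sub_iff_add_le, superlevelEnergy, superlevelEnergy, ← setIntegral_union hdisj hm
    (hint.mono_set fun _ hx => hx.1) (hint.mono_set fun _ hx => hx.1)]
  refine setIntegral_mono_set (hint.mono_set fun _ hx => hx.1)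
    (Eventually.of_forall fun _ => hA.nonneg (norm_nonneg _))
    (LE.le.eventuallyLE ?_)
  rintro x (hx | hx)
  · exact ⟨hx.1, hx.2.1⟩
  · exact ⟨hx.1, htt'.trans_lt hx.2⟩

variable {c R γ K : ℝ}

lemma mul_pow_mem_Icc (hc : 0 < c) (hcR : c * R ^ n = (volume Ω).toReal) {r : ℝ}
    (hr : r ∈ Icc 0 R) : c * r ^ n ∈ Icc 0 (volume Ω).toReal := by
  have h1 := hr.1
  refine ⟨by positivity, ?_⟩
  rw [← hcR]
  exact mul_le_mul_of_nonneg_left (pow_le_pow_left₀ hr.1 hr.2 n) hc.le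

lemma rearr_radial_antitoneOn (hΩ : volume Ω ≠ ⊤) (hw0 : ∀ x ∈ Ω, 0 ≤ w x)
    (hK : ∀ x ∈ Ω, w x ≤ K) (hc : 0 < c) (hcR : c * R ^ n = (volume Ω).toReal) :
    AntitoneOn (fun r => rearr Ω w (c * r ^ n)) (Icc 0 R) := fun _ hr _ hr' h =>
  rearr_antitoneOn hΩ hw0 hK (mul_pow_mem_Icc hc hcR hr) (mul_pow_mem_Icc hc hcR hr')
    (mul_le_mul_of_nonneg_left (pow_le_pow_left₀ hr.1 h n) hc.le)

lemma superlevelEnergy_radial_monotoneOn (hA : IsNFunction A) (hΩ : volume Ω ≠ ⊤)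
    (hw : LipschitzWith L w) (hw0 : ∀ x ∈ Ω, 0 ≤ w x) (hK : ∀ x ∈ Ω, w x ≤ K) (hc : 0 < c)
    (hcR : c * R ^ n = (volume Ω).toReal) :
    MonotoneOn (fun r => superlevelEnergy A Ω w (rearr Ω w (c * r ^ n))) (Icc 0 R) :=
  fun _ hr _ hr' h => superlevelEnergy_antitone hA hΩ hw
    (rearr_radial_antitoneOn hΩ hw0 hK hc hcR hr hr' h)

/-- The pointwise differential inequality behind the Pólya–Szegő principle. -/
lemma mul_map_deriv_rearr_le (hn : n ≠ 0) (hA : IsNFunction A) (hΩo : IsOpen Ω)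
    (hΩ : volume Ω ≠ ⊤) (hw : LipschitzWith L w) (hw0 : ∀ x ∈ Ω, 0 ≤ w x)
    (hK : ∀ x ∈ Ω, w x ≤ K) (hc : 0 < c) (hcR : c * R ^ n = (volume Ω).toReal) (hγ : 0 < γ)
    (hiso : ∀ t : ℝ, 0 ≤ t →
      γ * (distrib Ω w t) ^ ((1 : ℝ) - 1 / n) ≤ relPerimeter Ω {x ∈ Ω | t < w x})
    {r : ℝ} (hr : r ∈ Ioo 0 R)
    (hψ : DifferentiableAt ℝ (fun r => rearr Ω w (c * r ^ n)) r)
    (hG : DifferentiableAt ℝ (fun r => superlevelEnergy A Ω w (rearr Ω w (c * r ^ n))) r) :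
    c * (n * r ^ (n - 1)) *
        A (|deriv (fun r => rearr Ω w (c * r ^ n)) r| / (n * c ^ ((1 : ℝ) / n) / γ)) ≤
      deriv (fun r => superlevelEnergy A Ω w (rearr Ω w (c * r ^ n))) r := by
  have hr0 := hr.1
  have hψm := rearr_radial_antitoneOn hΩ hw0 hK hc hcR
  have hGm := superlevelEnergy_radial_monotoneOn hA hΩ hw hw0 hK hc hcR
  have hψd := hψ.hasDerivAt.tendsto_left_slope
  have hGd := hG.hasDerivAt.tendsto_left_slope
  have hψc := hψ.continuousAt
  set ψ : ℝ → ℝ := fun r => rearr Ω w (c * r ^ n)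
  set G : ℝ → ℝ := fun r => superlevelEnergy A Ω w (rearr Ω w (c * r ^ n))
  set q := deriv ψ r
  set g := deriv G r
  have hρ : HasDerivAt (fun r : ℝ => c * r ^ n) (c * (n * r ^ (n - 1))) r :=
    (hasDerivAt_pow n r).const_mul c
  have hρd := hρ.tendsto_left_slope
  set ρ' := c * (n * r ^ (n - 1)) with hρ'
  have hn0 : (0 : ℝ) < n := Nat.cast_pos.2 (Nat.pos_of_ne_zero hn)
  have hρ'0 : 0 < ρ' := by positivity
  have hk : ∀ᶠ k in 𝓝[>] (0 : ℝ), k ∈ Ioo 0 r := Ioo_mem_nhdsGT hr0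
  have hrk : ∀ k ∈ Ioo 0 r, r - k ∈ Icc 0 R := fun k hk =>
    ⟨by linarith [hk.2], by linarith [hk.1, hr.2]⟩
  have hrI : r ∈ Icc 0 R := ⟨hr.1.le, hr.2.le⟩
  have hs := mul_pow_mem_Icc hc hcR hrI
  have hsM : c * r ^ n < (volume Ω).toReal := by
    rw [← hcR]
    exact mul_lt_mul_of_pos_left (pow_lt_pow_left₀ hr.2 hr.1.le hn) hc
  have hg0 : 0 ≤ g := by
    refine ge_of_tendsto hGd ?_
    filter_upwards [hk] with k hk
    exact div_nonneg (sub_nonneg.2 (hGm (hrk k hk) hrI (by linarith [hk.1]))) hk.1.le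
  have hq0 : q ≤ 0 := by
    refine le_of_tendsto hψd ?_
    filter_upwards [hk] with k hk
    exact div_nonpos_of_nonpos_of_nonneg
      (sub_nonpos.2 (hψm (hrk k hk) hrI (by linarith [hk.1]))) hk.1.le
  rcases hq0.eq_or_lt with hqz | hqneg
  · rw [hqz, abs_zero, zero_div, hA.map_zero, mul_zero]
    exact hg0
  set t := ψ r with ht
  have ht0 : 0 ≤ t := rearr_nonneg hΩ hw0 hs.2
  have hμ : distrib Ω w t = c * r ^ n := by
    refine le_antisymm (distrib_rearr_le hΩ hK hs.1) ?_
    by_contra hlt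
    rw [not_le] at hlt
    have hcont : Tendsto (fun k : ℝ => c * (r - k) ^ n) (𝓝[>] 0) (𝓝 (c * r ^ n)) :=
      ((tendsto_const_sub_nhdsGT_zero r).pow n).const_mul c
    have hz : Tendsto (fun k => (ψ r - ψ (r - k)) / k) (𝓝[>] 0) (𝓝 0) := by
      refine tendsto_const_nhds.congr' ?_
      filter_upwards [hk, hcont.eventually_const_lt hlt] with k hk h1
      have hle : c * (r - k) ^ n ≤ c * r ^ n := mul_le_mul_of_nonneg_left
        (pow_le_pow_left₀ (hrk k hk).1 (by linarith [hk.1]) n) hc.le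
      have h2 : ψ (r - k) ≤ t := rearr_le hw0 (hle.trans_lt hsM) h1.le
      have h3 : t ≤ ψ (r - k) := hψm (hrk k hk) hrI (by linarith [hk.1])
      rw [le_antisymm h2 h3, ← ht, sub_self, zero_div]
    exact hqneg.ne (tendsto_nhds_unique hψd hz)
  set a₀ := γ * (c * r ^ n) ^ ((1 : ℝ) - 1 / n) with ha₀
  have ha₀0 : 0 < a₀ := by positivity
  have hper : a₀ ≤ relPerimeter Ω {x ∈ Ω | t < w x} := by
    have := hiso t ht0
    rwa [hμ] at this
  have hh : Tendsto (fun k => ψ (r - k) - t) (𝓝[>] 0) (𝓝[>] 0) := by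
    refine tendsto_nhdsWithin_iff.2 ⟨?_, ?_⟩
    · have h1 := tendsto_const_sub_nhdsGT_zero r
      have h2 := (hψc.tendsto.comp h1).sub_const t
      rwa [← ht, sub_self] at h2
    · filter_upwards [hk, hψd.eventually_lt_const hqneg] with k hk h1
      rw [div_lt_iff₀ hk.1, zero_mul] at h1
      simpa using h1
  have hkey : ∀ a ∈ Ico 0 a₀, A |(-q / ρ') * a| ≤ g / ρ' := fun a ha => by
    have hlim1 : Tendsto (fun k => A |(-((ψ r - ψ (r - k)) / k) /
        ((c * r ^ n - c * (r - k) ^ n) / k)) * a|) (𝓝[>] 0) (𝓝 (A |(-q / ρ') * a|)) :=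
      (hA.continuous_abs.tendsto _).comp ((hψd.neg.div hρd hρ'0.ne').mul_const a)
    have hlim2 := hGd.div hρd hρ'0.ne'
    refine le_of_tendsto_of_tendsto hlim1 hlim2 ?_
    filter_upwards [hk, hh.eventually (eventually_lt_of_lt_relPerimeter hΩo hΩ hw
      (ha.2.trans_le hper)), hh.eventually self_mem_nhdsWithin] with k hk h1 h2
    have h2 : 0 < ψ (r - k) - t := h2
    have hkr : r - k < r := by linarith [hk.1]
    have hρk : 0 < c * r ^ n - c * (r - k) ^ n := sub_pos.2
      (mul_lt_mul_of_pos_left (pow_lt_pow_left₀ hkr (hrk k hk).1 hn) hc)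
    rw [add_sub_cancel] at h1
    have hvol := measureReal_layer_le hΩo hΩ hw.continuous hw0 hK
      (mul_pow_mem_Icc hc hcR (hrk k hk)).1 (sub_pos.1 hρk).le hsM
    change volume.real {x ∈ Ω | t < w x ∧ w x < ψ (r - k)} ≤ _ at hvol
    have hint := hA.integrableOn_norm_fderiv hΩ hw
    have hJ := hA.map_setIntegral_le (measure_ne_top_of_subset (fun _ hx => hx.1) hΩ) hρk hvol
      (fun x => norm_nonneg (fderiv ℝ w x))
      ((integrableOn_comp_norm_fderiv hΩ hw continuous_id).mono_set fun _ hx => hx.1)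
      (hint.mono_set fun _ hx => hx.1)
    have hlay := setIntegral_layer_le hA hΩo hΩ hw (sub_pos.1 h2).le
    change _ ≤ G r - G (r - k) at hlay
    have hk0 := hk.1
    have e1 : -((ψ r - ψ (r - k)) / k) / ((c * r ^ n - c * (r - k) ^ n) / k) * a =
        (c * r ^ n - c * (r - k) ^ n)⁻¹ * ((ψ (r - k) - t) * a) := by
      rw [← ht]
      field_simp
      ring
    have e2 : (G r - G (r - k)) / k / ((c * r ^ n - c * (r - k) ^ n) / k) =
        (c * r ^ n - c * (r - k) ^ n)⁻¹ * (G r - G (r - k)) := by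
      field_simp
    have hnn : 0 ≤ (c * r ^ n - c * (r - k) ^ n)⁻¹ * ((ψ (r - k) - t) * a) :=
      mul_nonneg (inv_pos.2 hρk).le (mul_nonneg h2.le ha.1)
    change A |-((ψ r - ψ (r - k)) / k) / ((c * r ^ n - c * (r - k) ^ n) / k) * a| ≤
      (G r - G (r - k)) / k / ((c * r ^ n - c * (r - k) ^ n) / k)
    rw [e1, e2, abs_of_nonneg hnn]
    refine (hA.mono hnn ?_).trans (hJ.trans (mul_le_mul_of_nonneg_left hlay (inv_pos.2 hρk).le))
    refine mul_le_mul_of_nonneg_left ?_ (inv_pos.2 hρk).le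
    rw [lt_inv_mul_iff₀ h2] at h1
    exact h1.le
  have hfin : A |(-q / ρ') * a₀| ≤ g / ρ' := by
    have hlim : Tendsto (fun a => A |(-q / ρ') * a|) (𝓝[<] a₀) (𝓝 (A |(-q / ρ') * a₀|)) :=
      ((hA.continuous_abs.comp (continuous_const.mul continuous_id)).tendsto a₀).mono_left
        nhdsWithin_le_nhds
    refine le_of_tendsto hlim ?_
    filter_upwards [Ioo_mem_nhdsLT ha₀0] with a ha using hkey a ⟨ha.1.le, ha.2⟩
  rw [abs_of_nonneg (mul_nonneg (div_nonneg (neg_nonneg.2 hq0) hρ'0.le) ha₀0.le), hρ', ha₀,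
    rpow_isoperimetric_identity hn hc hr0 hγ, ← hρ', ← abs_of_nonpos hq0, le_div_iff₀ hρ'0,
    mul_comm] at hfin
  exact hfin

end Radial

section Symmetrization

variable {n : ℕ} {A : ℝ → ℝ} {Ω : Set (EuclideanSpace ℝ (Fin n))}
  {w : EuclideanSpace ℝ (Fin n) → ℝ} {L : NNReal}

lemma setIntegral_ball_fun_norm [Nontrivial (EuclideanSpace ℝ (Fin n))] (f : ℝ → ℝ) (R : ℝ) :
    ∫ x in ball (0 : EuclideanSpace ℝ (Fin n)) R, f ‖x‖ =
      ∫ r in Ioo 0 R, unitBallVol n * (n * r ^ (n - 1)) * f r := by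
  have h1 : ∀ x : EuclideanSpace ℝ (Fin n),
      (ball (0 : EuclideanSpace ℝ (Fin n)) R).indicator (fun x => f ‖x‖) x =
        (Iio R).indicator f ‖x‖ := fun x => by
    by_cases hx : ‖x‖ < R <;> simp [indicator, hx]
  rw [← integral_indicator measurableSet_ball]
  simp only [h1]
  rw [integral_fun_norm_addHaar, finrank_euclideanSpace_fin]
  have h2 : ∀ r : ℝ, r ^ (n - 1) • (Iio R).indicator f r =
      (Iio R).indicator (fun r => r ^ (n - 1) * f r) r := fun r => by
    by_cases hr : r < R <;> simp [indicator, hr]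
  simp only [h2]
  rw [setIntegral_indicator measurableSet_Iio, Ioi_inter_Iio, nsmul_eq_mul, smul_eq_mul,
    ← integral_const_mul, ← integral_const_mul]
  refine integral_congr_ae (Eventually.of_forall fun r => ?_)
  change (n : ℝ) * (unitBallVol n * (r ^ (n - 1) * f r)) = _
  ring

/-- At nonzero points the gradient of a radial function is controlled by the derivative of its
profile, with no differentiability assumption. -/
lemma norm_fderiv_comp_norm_le {V : Type*} [NormedAddCommGroup V] [InnerProductSpace ℝ V]
    (ψ : ℝ → ℝ) {x : V} (hx : x ≠ 0) : ‖fderiv ℝ (fun y : V => ψ ‖y‖) x‖ ≤ |deriv ψ ‖x‖| := by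
  by_cases hd : DifferentiableAt ℝ (fun y : V => ψ ‖y‖) x
  · have hx0 : 0 < ‖x‖ := norm_pos_iff.2 hx
    have hψ : DifferentiableAt ℝ ψ ‖x‖ := by
      have hx1 : ‖x‖ • (‖x‖⁻¹ • x) = x := by rw [smul_smul, mul_inv_cancel₀ hx0.ne', one_smul]
      have hl : DifferentiableAt ℝ (fun r : ℝ => r • (‖x‖⁻¹ • x)) ‖x‖ := by fun_prop
      have hcomp : DifferentiableAt ℝ (fun r : ℝ => ψ ‖r • (‖x‖⁻¹ • x)‖) ‖x‖ :=
        DifferentiableAt.comp (g := fun y : V => ψ ‖y‖) ‖x‖ (by rwa [hx1]) hl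
      refine hcomp.congr_of_eventuallyEq ?_
      filter_upwards [lt_mem_nhds hx0] with r hr
      rw [norm_smul, norm_smul, norm_inv, norm_norm, inv_mul_cancel₀ hx0.ne', mul_one,
        Real.norm_eq_abs, abs_of_pos hr]
    have hN : DifferentiableAt ℝ (fun y : V => ‖y‖) x := differentiableAt_id.norm ℝ hx
    have h := (hψ.hasDerivAt.comp_hasFDerivAt x hN.hasFDerivAt).fderiv
    change fderiv ℝ (fun y : V => ψ ‖y‖) x = _ at h
    rw [h, norm_smul, Real.norm_eq_abs]
    refine mul_le_of_le_one_right (abs_nonneg _) ?_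
    simpa using norm_fderiv_le_of_lipschitz ℝ (lipschitzWith_one_norm (E := V)) (x₀ := x)
  · rw [fderiv_zero_of_not_differentiableAt hd, norm_zero]
    exact abs_nonneg _

lemma unitBallVol_pos (n : ℕ) : 0 < unitBallVol n :=
  ENNReal.toReal_pos (measure_ball_pos volume _ one_pos).ne' measure_ball_lt_top.ne

lemma schwarz_congr {u : EuclideanSpace ℝ (Fin n) → ℝ} (h : EqOn u w Ω) :
    schwarz Ω u = schwarz Ω w := by
  have : ∀ t, {x ∈ Ω | t < u x} = {x ∈ Ω | t < w x} := fun t => by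
    ext x
    exact and_congr_right fun hx => by rw [h hx]
  funext x
  simp only [schwarz, rearr, distrib, this]

/-- The Pólya–Szegő inequality for an Orlicz energy, for a globally Lipschitz function. -/
lemma setIntegral_schwarz_le (hn : 2 ≤ n) (hA : IsNFunction A) (hΩo : IsOpen Ω)
    (hΩbd : Bornology.IsBounded Ω) (hw : LipschitzWith L w) (hw0 : ∀ x ∈ Ω, 0 ≤ w x)
    {γ : ℝ} (hγ : 0 < γ)
    (hiso : ∀ t : ℝ, 0 ≤ t →
      γ * (distrib Ω w t) ^ ((1 : ℝ) - 1 / n) ≤ relPerimeter Ω {x ∈ Ω | t < w x}) :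
    ∫ x in ballSameVol Ω,
        A (‖fderiv ℝ (schwarz Ω w) x‖ / ((n : ℝ) * (unitBallVol n) ^ ((1 : ℝ) / n) / γ))
      ≤ ∫ x in Ω, A ‖fderiv ℝ w x‖ := by
  have hn0 : n ≠ 0 := by omega
  have : Nonempty (Fin n) := ⟨⟨0, by omega⟩⟩
  have : Nontrivial (EuclideanSpace ℝ (Fin n)) := inferInstance
  have hΩ : volume Ω ≠ ⊤ := hΩbd.measure_lt_top.ne
  have hc := unitBallVol_pos n
  obtain ⟨K, hK⟩ : ∃ K, ∀ x ∈ Ω, w x ≤ K := by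
    obtain ⟨K, hK⟩ := (hw.isBounded_image hΩbd).bddAbove
    exact ⟨K, fun x hx => hK (mem_image_of_mem w hx)⟩
  have hball : ballSameVol Ω = ball 0 (((volume Ω).toReal / unitBallVol n) ^ ((1 : ℝ) / n)) := rfl
  have hsch : schwarz Ω w = fun x => (fun r => rearr Ω w (unitBallVol n * r ^ n)) ‖x‖ := rfl
  rw [hball, hsch]
  set c := unitBallVol n
  set R := ((volume Ω).toReal / c) ^ ((1 : ℝ) / n) with hR
  have hR0 : 0 ≤ R := by positivity
  have hcR : c * R ^ n = (volume Ω).toReal := by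
    rw [hR, one_div, Real.rpow_inv_natCast_pow (by positivity) hn0]
    field_simp
  set lam : ℝ := n * c ^ ((1 : ℝ) / n) / γ with hlam
  have hlam0 : 0 < lam := by
    have : (0 : ℝ) < n := Nat.cast_pos.2 (Nat.pos_of_ne_zero hn0)
    positivity
  set ψ : ℝ → ℝ := fun r => rearr Ω w (c * r ^ n) with hψ
  set G : ℝ → ℝ := fun r => superlevelEnergy A Ω w (rearr Ω w (c * r ^ n)) with hG
  have hψm : AntitoneOn ψ (Icc 0 R) := rearr_radial_antitoneOn hΩ hw0 hK hc hcR
  have hGm : MonotoneOn G (Icc 0 R) := superlevelEnergy_radial_monotoneOn hA hΩ hw hw0 hK hc hcR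
  have hGi : IntegrableOn (deriv G) (Ioo 0 R) := by
    have := MonotoneOn.intervalIntegrable_deriv (f := G) (a := 0) (b := R) (by rwa [uIcc_of_le hR0])
    exact ((intervalIntegrable_iff_integrableOn_Ioc_of_le hR0).1 this).mono_set Ioo_subset_Ioc_self
  have hGle : ∫ r in Ioo 0 R, deriv G r ≤ ∫ x in Ω, A ‖fderiv ℝ w x‖ := by
    have h1 := MonotoneOn.intervalIntegral_deriv_mem_uIcc (f := G) (a := 0) (b := R)
      (by rwa [uIcc_of_le hR0])
    rw [uIcc_of_le (sub_nonneg.2 (hGm (left_mem_Icc.2 hR0) (right_mem_Icc.2 hR0) hR0)),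
      intervalIntegral.integral_of_le hR0, integral_Ioc_eq_integral_Ioo] at h1
    have h2 : G R ≤ ∫ x in Ω, A ‖fderiv ℝ w x‖ := superlevelEnergy_le hA hΩ hw _
    have h3 : 0 ≤ G 0 := superlevelEnergy_nonneg hA _
    linarith [h1.2]
  have hae : ∀ᵐ r ∂volume.restrict (Ioo 0 R),
      c * (n * r ^ (n - 1)) * A (|deriv ψ r| / lam) ≤ deriv G r := by
    rw [ae_restrict_iff' measurableSet_Ioo]
    filter_upwards [hψm.neg.ae_differentiableWithinAt_of_mem,
      hGm.ae_differentiableWithinAt_of_mem] with r h1 h2 hr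
    have hnhds := Icc_mem_nhds hr.1 hr.2
    have h3 := ((h1 (Ioo_subset_Icc_self hr)).differentiableAt hnhds).fun_neg
    simp only [neg_neg] at h3
    exact mul_map_deriv_rearr_le hn0 hA hΩo hΩ hw hw0 hK hc hcR hγ hiso hr h3
      ((h2 (Ioo_subset_Icc_self hr)).differentiableAt hnhds)
  have hmeas : Measurable fun r => A (|deriv ψ r| / lam) := by
    have h := hA.continuous_abs.measurable.comp ((measurable_deriv ψ).norm.div_const lam)
    have heq : (fun r => A (|deriv ψ r| / lam)) =
        (fun t => A |t|) ∘ fun r => ‖deriv ψ r‖ / lam := by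
      funext r
      simp only [Function.comp, Real.norm_eq_abs]
      rw [abs_of_nonneg (div_nonneg (abs_nonneg _) hlam0.le)]
    rwa [heq]
  have hnonneg : ∀ r, 0 ≤ A (|deriv ψ r| / lam) := fun r => hA.nonneg (by positivity)
  have hint : IntegrableOn (fun r => c * (n * r ^ (n - 1)) * A (|deriv ψ r| / lam)) (Ioo 0 R) := by
    have hpow : Measurable fun r : ℝ => c * (n * r ^ (n - 1)) := by fun_prop
    refine hGi.mono' (hpow.mul hmeas).aestronglyMeasurable ?_
    filter_upwards [hae, self_mem_ae_restrict measurableSet_Ioo] with r h1 h2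
    have h3 := h2.1
    rwa [Real.norm_eq_abs, abs_of_nonneg (mul_nonneg (by positivity) (hnonneg r))]
  have hintball : IntegrableOn (fun x : EuclideanSpace ℝ (Fin n) => A (|deriv ψ ‖x‖| / lam))
      (ball 0 R) := by
    rw [integrableOn_fun_norm_addHaar volume (f := fun r => A (|deriv ψ r| / lam)),
      finrank_euclideanSpace_fin]
    refine (hint.const_mul (c * n)⁻¹).congr (Eventually.of_forall fun r => ?_)
    have : (n : ℝ) ≠ 0 := Nat.cast_ne_zero.2 hn0
    simp only [smul_eq_mul]
    field_simp
  calc ∫ x in ball (0 : EuclideanSpace ℝ (Fin n)) R, A (‖fderiv ℝ (fun x => ψ ‖x‖) x‖ / lam)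
      ≤ ∫ x in ball (0 : EuclideanSpace ℝ (Fin n)) R, A (|deriv ψ ‖x‖| / lam) := by
        refine integral_mono_of_nonneg
          (Eventually.of_forall fun x => hA.nonneg (by positivity)) hintball
          (ae_restrict_of_ae ?_)
        filter_upwards [compl_mem_ae_iff.2 (measure_singleton (0 : EuclideanSpace ℝ (Fin n)))]
          with x hx
        exact hA.mono (by positivity)
          (div_le_div_of_nonneg_right (norm_fderiv_comp_norm_le ψ hx) hlam0.le)
    _ = ∫ r in Ioo 0 R, c * (n * r ^ (n - 1)) * A (|deriv ψ r| / lam) :=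
        setIntegral_ball_fun_norm (fun r => A (|deriv ψ r| / lam)) R
    _ ≤ ∫ r in Ioo 0 R, deriv G r := integral_mono_ae hint hGi hae
    _ ≤ _ := hGle

lemma exists_pos_setIntegral_le_one (hA : IsNFunction A) (hΩ : volume Ω ≠ ⊤)
    (hw : LipschitzWith L w) :
    {lam : ℝ | 0 < lam ∧ ∫ x in Ω, A (|‖fderiv ℝ w x‖| / lam) ≤ 1}.Nonempty := by
  have h1 : Tendsto (fun lam : ℝ => A |(L : ℝ) / lam| * volume.real Ω) atTop (𝓝 0) := by
    have h2 : Tendsto (fun lam : ℝ => (L : ℝ) / lam) atTop (𝓝 0) :=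
      tendsto_const_nhds.div_atTop tendsto_id
    have h3 := ((hA.continuous_abs.tendsto 0).comp h2).mul_const (volume.real Ω)
    simpa [hA.map_zero] using h3
  obtain ⟨lam, h2, h3⟩ := ((h1.eventually_lt_const one_pos).and (eventually_gt_atTop 0)).exists
  refine ⟨lam, h3, le_trans ?_ h2.le⟩
  refine (Real.le_norm_self _).trans
    (norm_setIntegral_le_of_norm_le_const (C := A |(L : ℝ) / lam|) hΩ.lt_top fun x _ => ?_)
  have h4 : ‖fderiv ℝ w x‖ ≤ L := norm_fderiv_le_of_lipschitz ℝ hw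
  rw [Real.norm_eq_abs, abs_of_nonneg (hA.nonneg (by positivity)), abs_norm,
    abs_of_nonneg (div_nonneg L.coe_nonneg h3.le)]
  exact hA.mono (by positivity) (div_le_div_of_nonneg_right h4 h3.le)

end Symmetrization

theorem orlicz_polya_szego {n : ℕ} (hn : 2 ≤ n)
    (A : ℝ → ℝ) (hA : IsNFunction A)
    (Ω : Set (EuclideanSpace ℝ (Fin n)))
    (hΩo : IsOpen Ω) (hΩbd : Bornology.IsBounded Ω)
    (u : EuclideanSpace ℝ (Fin n) → ℝ)
    (L : NNReal) (hu : LipschitzOnWith L u Ω) (hu0 : ∀ x ∈ Ω, 0 ≤ u x)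
    (γ : ℝ) (hγ : 0 < γ)
    (hiso : ∀ t : ℝ, 0 ≤ t →
      γ * (distrib Ω u t) ^ ((1 : ℝ) - 1 / n) ≤ relPerimeter Ω {x ∈ Ω | t < u x}) :
    (∫ x in ballSameVol Ω,
        A (‖fderiv ℝ (schwarz Ω u) x‖ / ((n : ℝ) * (unitBallVol n) ^ ((1 : ℝ) / n) / γ))
      ≤ ∫ x in Ω, A ‖fderiv ℝ u x‖) ∧
    luxNorm A (ballSameVol Ω) (fun x => ‖fderiv ℝ (schwarz Ω u) x‖)
      ≤ ((n : ℝ) * (unitBallVol n) ^ ((1 : ℝ) / n) / γ)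
        * luxNorm A Ω (fun x => ‖fderiv ℝ u x‖) := by
  obtain ⟨w, hw, huw⟩ := hu.extend_real
  have hset : ∀ t, {x ∈ Ω | t < u x} = {x ∈ Ω | t < w x} := fun t => by
    ext x
    exact and_congr_right fun hx => by rw [huw hx]
  have hfd : ∀ x ∈ Ω, fderiv ℝ u x = fderiv ℝ w x := fun x hx =>
    (huw.eventuallyEq_of_mem (hΩo.mem_nhds hx)).fderiv_eq
  have hw0 : ∀ x ∈ Ω, 0 ≤ w x := fun x hx => huw hx ▸ hu0 x hx
  simp only [distrib, hset] at hiso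
  have hmain : ∀ B : ℝ → ℝ, IsNFunction B → ∫ x in ballSameVol Ω,
      B (‖fderiv ℝ (schwarz Ω u) x‖ / ((n : ℝ) * (unitBallVol n) ^ ((1 : ℝ) / n) / γ)) ≤
        ∫ x in Ω, B ‖fderiv ℝ u x‖ := fun B hB => by
    rw [schwarz_congr huw, setIntegral_congr_fun hΩo.measurableSet
      (g := fun x => B ‖fderiv ℝ w x‖) fun x hx => by simp only [hfd x hx]]
    exact setIntegral_schwarz_le hn hB hΩo hΩbd hw hw0 hγ hiso
  refine ⟨hmain A hA, ?_⟩
  have hlam : 0 < (n : ℝ) * (unitBallVol n) ^ ((1 : ℝ) / n) / γ := by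
    have h1 : (0 : ℝ) < n := Nat.cast_pos.2 (by omega)
    have h2 := unitBallVol_pos n
    positivity
  have hne : {lam : ℝ | 0 < lam ∧ ∫ x in Ω, A (|‖fderiv ℝ u x‖| / lam) ≤ 1}.Nonempty := by
    obtain ⟨lam, h1, h2⟩ := exists_pos_setIntegral_le_one hA hΩbd.measure_lt_top.ne hw
    refine ⟨lam, h1, ?_⟩
    rwa [setIntegral_congr_fun hΩo.measurableSet
      (g := fun x => A (|‖fderiv ℝ w x‖| / lam)) fun x hx => by simp only [hfd x hx]]
  rw [mul_comm, ← div_le_iff₀ hlam]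
  refine le_csInf hne fun lam hl => ?_
  rw [div_le_iff₀ hlam]
  refine csInf_le ⟨0, fun _ h => h.1.le⟩ ⟨mul_pos hl.1 hlam, ?_⟩
  have h1 := hmain _ (hA.comp_div hl.1)
  have h2 := hl.2
  simp only [abs_norm] at h2 ⊢
  refine le_trans (le_of_eq ?_) (h1.trans h2)
  simp only [div_div, mul_comm lam]
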